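/- Assume the mechanical setting, and let X_{H,M}(x) := DΓ(x) · X_H(x) for x ∈ M×ℝ be the constrained Hamiltonian vector field. Then the contact Eden bracket provides the evolution of observables: for every smooth f : ℝⁿ × ℝⁿ × ℝ → ℝ and every x ∈ M×ℝ, df(x)(X_{H,M}(x)) = {H, f}_E(x) − f(x) · ∂H/∂z(x). -/

import Mathlib

open scoped BigOperators Matrix
noncomputable section

/-- Phase space `ℝⁿ × ℝⁿ × ℝ`, modeling `T*Q × ℝ` for `Q = ℝⁿ`. -/
abbrev PS (n : ℕ) := (Fin n → ℝ) × (Fin n → ℝ) × ℝ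

/-- Partial derivative in the `qⁱ` direction. -/
def pdq {n : ℕ} (F : PS n → ℝ) (x : PS n) (i : Fin n) : ℝ :=
  fderiv ℝ F x (Pi.single i 1, 0, 0)

/-- Partial derivative in the `pᵢ` direction. -/
def pdp {n : ℕ} (F : PS n → ℝ) (x : PS n) (i : Fin n) : ℝ :=
  fderiv ℝ F x (0, Pi.single i 1, 0)

/-- Partial derivative in the `z` direction. -/
def pdz {n : ℕ} (F : PS n → ℝ) (x : PS n) : ℝ :=
  fderiv ℝ F x (0, 0, 1)

/-- The flat map `♭ₓ(v) = ι_v dη + η(v) η` at `x = (q,p,z)`, for `η = dz − Σ pᵢ dqⁱ`;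
covectors are identified with triples (dq-components, dp-components, dz-component). -/
def flatMap {n : ℕ} (x : PS n) (v : PS n) : PS n :=
  (fun i => -v.2.1 i - (v.2.2 - ∑ j, x.2.1 j * v.1 j) * x.2.1 i,
   v.1,
   v.2.2 - ∑ j, x.2.1 j * v.1 j)

/-- The contact Hamiltonian vector field of `F`. -/
def XH {n : ℕ} (F : PS n → ℝ) (x : PS n) : PS n :=
  (fun i => pdp F x i,
   fun i => -pdq F x i - x.2.1 i * pdz F x,
   (∑ i, x.2.1 i * pdp F x i) - F x)

/-- The contact (Jacobi) bracket. -/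
def jacB {n : ℕ} (f g : PS n → ℝ) (x : PS n) : ℝ :=
  (∑ i, (pdp f x i * pdq g x i - pdp g x i * pdq f x i))
  + (∑ i, x.2.1 i * (pdp f x i * pdz g x - pdp g x i * pdz f x))
  + g x * pdz f x - f x * pdz g x

/-- The differential of `F` at `x`, as a covector triple. -/
def dCov {n : ℕ} (F : PS n → ℝ) (x : PS n) : PS n :=
  (fun i => pdq F x i, fun i => pdp F x i, pdz F x)

/-- The contact form `η = dz − Σ pᵢ dqⁱ` at `x`, as a covector triple. -/
def etaCov {n : ℕ} (x : PS n) : PS n :=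
  (fun i => -x.2.1 i, 0, 1)

/-- The mechanical setting: a smooth Riemannian metric `G` on `ℝⁿ`, a smooth potential `V`,
and a smooth fiberwise projection `P` (idempotent, `G⁻¹`-symmetric) onto the constraint
subbundle along the annihilator of the constraint distribution. -/
structure MechSetting (n : ℕ) where
  hn : 1 ≤ n
  G : (Fin n → ℝ) → Matrix (Fin n) (Fin n) ℝ
  V : (Fin n → ℝ) × ℝ → ℝ
  P : (Fin n → ℝ) → Matrix (Fin n) (Fin n) ℝ
  G_smooth : ∀ i j, ContDiff ℝ (⊤ : ℕ∞) (fun q => G q i j)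
  G_symm : ∀ q, (G q).IsSymm
  G_posdef : ∀ q, (G q).PosDef
  V_smooth : ContDiff ℝ (⊤ : ℕ∞) V
  P_smooth : ∀ i j, ContDiff ℝ (⊤ : ℕ∞) (fun q => P q i j)
  P_proj : ∀ q, P q * P q = P q
  P_symm : ∀ q, (P q)ᵀ * (G q)⁻¹ = (G q)⁻¹ * P q

namespace MechSetting

variable {n : ℕ} (S : MechSetting n)

/-- The mechanical Hamiltonian `H(q,p,z) = ½ pᵀ G(q)⁻¹ p + V(q,z)`. -/
def H (x : PS n) : ℝ :=
  (1 / 2) * (∑ i, ∑ j, x.2.1 i * (S.G x.1)⁻¹ i j * x.2.1 j) + S.V (x.1, x.2.2)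

/-- The projection `Γ(q,p,z) = (q, P(q)p, z)` onto `M×ℝ`. -/
def Gam (x : PS n) : PS n :=
  (x.1, (S.P x.1).mulVec x.2.1, x.2.2)

/-- Membership in the constraint submanifold `M×ℝ = {(q,p,z) : P(q)p = p}`. -/
def onM (x : PS n) : Prop :=
  (S.P x.1).mulVec x.2.1 = x.2.1

/-- The constraint distribution `D(q) = {G(q)⁻¹ m : P(q) m = m}`. -/
def Dd (q : Fin n → ℝ) : Set (Fin n → ℝ) :=
  {v | ∃ m, (S.P q).mulVec m = m ∧ v = ((S.G q)⁻¹).mulVec m}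

/-- Entrywise partial derivative `∂P/∂qⁱ` of the matrix-valued map `P`. -/
def dP (q : Fin n → ℝ) (i : Fin n) : Matrix (Fin n) (Fin n) ℝ :=
  fun j k => fderiv ℝ (fun q' => S.P q' j k) q (Pi.single i 1)

end MechSetting

/-- The annihilator `D° = {α ∈ ℝⁿ : Σᵢ αᵢ vᵢ = 0 for all v ∈ D}` of a subspace `D ⊆ ℝⁿ`. -/
def annih {n : ℕ} (D : Submodule ℝ (Fin n → ℝ)) : Submodule ℝ (Fin n → ℝ) where
  carrier := {α | ∀ v ∈ D, ∑ i, α i * v i = 0}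
  zero_mem' := by intro v hv; simp
  add_mem' := by
    intro a b ha hb v hv
    have h1 := ha v hv
    have h2 := hb v hv
    simp only [Pi.add_apply, add_mul, Finset.sum_add_distrib, h1, h2, add_zero]
  smul_mem' := by
    intro c a ha v hv
    simp only [Pi.smul_apply, smul_eq_mul, mul_assoc, ← Finset.mul_sum, ha v hv, mul_zero]

namespace Matrix

variable {E ι : Type*} [NormedAddCommGroup E] [NormedSpace ℝ E] [Fintype ι] [DecidableEq ι]

theorem differentiable_det {A : E → Matrix ι ι ℝ}
    (hA : ∀ i j, Differentiable ℝ fun e => A e i j) : Differentiable ℝ fun e => (A e).det := by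
  simp only [det_apply']
  fun_prop

theorem differentiable_inv_apply {A : E → Matrix ι ι ℝ}
    (hA : ∀ i j, Differentiable ℝ fun e => A e i j) (h0 : ∀ e, (A e).det ≠ 0) (i j : ι) :
    Differentiable ℝ fun e => (A e)⁻¹ i j := by
  have hadj : Differentiable ℝ fun e => (A e).adjugate i j := by
    simp only [adjugate_apply]
    refine differentiable_det fun k l => ?_
    by_cases hk : k = j
    · subst hk
      simp
    · simpa [updateRow_ne hk] using hA k l
  simp only [inv_def, smul_apply, Ring.inverse_eq_inv', smul_eq_mul]
  exact ((differentiable_det hA).inv h0).mul hadj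

end Matrix

/-- A linear functional on phase space is determined by its values on the coordinate vectors. -/
theorem PS.map_eq_sum {n : ℕ} (φ : PS n →L[ℝ] ℝ) (v : PS n) :
    φ v = (∑ i, v.1 i * φ (Pi.single i 1, 0, 0)) + (∑ i, v.2.1 i * φ (0, Pi.single i 1, 0))
      + v.2.2 * φ (0, 0, 1) := by
  have hv : v = (∑ i, v.1 i • ((Pi.single i 1, 0, 0) : PS n))
      + (∑ i, v.2.1 i • ((0, Pi.single i 1, 0) : PS n)) + v.2.2 • ((0, 0, 1) : PS n) := by
    ext j <;> simp [Prod.fst_sum, Prod.snd_sum, Finset.sum_apply, Pi.single_apply]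
  conv_lhs => rw [hv]
  simp only [map_add, map_sum, map_smul, smul_eq_mul]

/-- The contact Hamiltonian vector field of `F`, applied to an observable `g`, is
`{F, g} - g ∂F/∂z`. -/
theorem fderiv_XH {n : ℕ} (F g : PS n → ℝ) (x : PS n) :
    fderiv ℝ g x (XH F x) = jacB F g x - g x * pdz F x := by
  rw [PS.map_eq_sum]
  have hp : ∑ i, (-pdq F x i - x.2.1 i * pdz F x) * pdp g x i
      = -(∑ i, pdp g x i * pdq F x i) - ∑ i, x.2.1 i * (pdp g x i * pdz F x) := by
    rw [← Finset.sum_neg_distrib, ← Finset.sum_sub_distrib]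
    exact Finset.sum_congr rfl fun i _ => by ring
  have hz : ∑ i, x.2.1 i * (pdp F x i * pdz g x) = (∑ i, x.2.1 i * pdp F x i) * pdz g x := by
    rw [Finset.sum_mul]
    exact Finset.sum_congr rfl fun i _ => by ring
  simp only [XH, jacB, ← pdq.eq_def, ← pdp.eq_def, ← pdz.eq_def, mul_sub,
    Finset.sum_sub_distrib, hp, hz]
  ring

theorem jacB_congr {n : ℕ} {F F' : PS n → ℝ} (g : PS n → ℝ) {x : PS n} (h : F x = F' x)
    (h' : fderiv ℝ F x = fderiv ℝ F' x) : jacB F g x = jacB F' g x := by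
  simp only [jacB, pdq, pdp, pdz, h, h']

namespace MechSetting

variable {n : ℕ} (S : MechSetting n)

theorem differentiable_Gam : Differentiable ℝ S.Gam := by
  have hP : ∀ i j, Differentiable ℝ fun q => S.P q i j :=
    fun i j => (S.P_smooth i j).differentiable (by simp)
  unfold Gam Matrix.mulVec dotProduct
  fun_prop

theorem differentiable_H : Differentiable ℝ S.H := by
  have hG : ∀ i j, Differentiable ℝ fun q => (S.G q)⁻¹ i j :=
    Matrix.differentiable_inv_apply (fun i j => (S.G_smooth i j).differentiable (by simp))
      fun q => (S.G_posdef q).det_pos.ne'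
  have hV : Differentiable ℝ S.V := S.V_smooth.differentiable (by simp)
  have hq : ∀ i j, Differentiable ℝ fun x : PS n => (S.G x.1)⁻¹ i j :=
    fun i j => (hG i j).comp differentiable_fst
  have hVx : Differentiable ℝ fun x : PS n => S.V (x.1, x.2.2) :=
    hV.comp (by fun_prop : Differentiable ℝ fun x : PS n => (x.1, x.2.2))
  unfold H
  refine Differentiable.add (Differentiable.const_mul ?_ _) hVx
  refine Differentiable.fun_sum fun i _ => Differentiable.fun_sum fun j _ => ?_
  exact ((by fun_prop : Differentiable ℝ fun x : PS n => x.2.1 i).mul (hq i j)).mul (by fun_prop)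

theorem Gam_eq_self {x : PS n} (hx : S.onM x) : S.Gam x = x := by
  unfold Gam
  rw [show (S.P x.1).mulVec x.2.1 = x.2.1 from hx]

theorem Gam_comp_Gam : S.Gam ∘ S.Gam = S.Gam := by
  funext x
  simp [Gam, Matrix.mulVec_mulVec, S.P_proj]

theorem fderiv_comp_Gam {F : PS n → ℝ} (hF : Differentiable ℝ F) {x : PS n} (hx : S.onM x)
    (v : PS n) : fderiv ℝ (F ∘ S.Gam) x v = fderiv ℝ F x (fderiv ℝ S.Gam x v) := by
  rw [fderiv_comp x hF.differentiableAt S.differentiable_Gam.differentiableAt, S.Gam_eq_self hx]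
  rfl

theorem fderiv_Gam_fderiv_Gam {x : PS n} (hx : S.onM x) (v : PS n) :
    fderiv ℝ S.Gam x (fderiv ℝ S.Gam x v) = fderiv ℝ S.Gam x v := by
  have h := fderiv_comp x (S.differentiable_Gam.differentiableAt (x := S.Gam x))
    S.differentiable_Gam.differentiableAt
  rw [S.Gam_comp_Gam, S.Gam_eq_self hx] at h
  exact (DFunLike.congr_fun h v).symm

theorem fderiv_Gam_fst (x v : PS n) : (fderiv ℝ S.Gam x v).1 = v.1 := by
  have h := (S.differentiable_Gam x).hasFDerivAt.fst.unique (hasFDerivAt_fst (p := x))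
  exact DFunLike.congr_fun h v

theorem fderiv_Gam_snd_snd (x v : PS n) : (fderiv ℝ S.Gam x v).2.2 = v.2.2 := by
  have h' := ((ContinuousLinearMap.snd ℝ (Fin n → ℝ) ℝ).comp
    (ContinuousLinearMap.snd ℝ (Fin n → ℝ) ((Fin n → ℝ) × ℝ))).hasFDerivAt (x := x)
  have h := (S.differentiable_Gam x).hasFDerivAt.snd.snd.unique h'
  exact DFunLike.congr_fun h v

theorem fderiv_Gam_momentum (x : PS n) (w : Fin n → ℝ) :
    fderiv ℝ S.Gam x (0, w, 0) = (0, (S.P x.1).mulVec w, 0) := by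
  rw [← (S.differentiable_Gam x).lineDeriv_eq_fderiv]
  refine HasLineDerivAt.lineDeriv ?_
  have h : (fun t : ℝ => S.Gam (x + t • ((0, w, 0) : PS n)))
      = fun t => S.Gam x + t • ((0, (S.P x.1).mulVec w, 0) : PS n) := by
    funext t
    simp [Gam, Matrix.mulVec_add, Matrix.mulVec_smul]
  unfold HasLineDerivAt
  rw [h]
  simpa using ((hasDerivAt_id (0 : ℝ)).smul_const
    ((0, (S.P x.1).mulVec w, 0) : PS n)).const_add (S.Gam x)

theorem H_eq (x : PS n) :
    S.H x = (1 / 2) * (x.2.1 ⬝ᵥ (S.G x.1)⁻¹ *ᵥ x.2.1) + S.V (x.1, x.2.2) := by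
  simp [H, Matrix.mulVec, dotProduct, Finset.mul_sum, mul_assoc]

/-- On the constraint submanifold, the kernel of the projection is orthogonal to the momentum. -/
theorem fderiv_H_momentum_eq_zero {x : PS n} (hx : S.onM x) {w : Fin n → ℝ}
    (hw : (S.P x.1).mulVec w = 0) : fderiv ℝ S.H x (0, w, 0) = 0 := by
  have hx' : S.P x.1 *ᵥ x.2.1 = x.2.1 := hx
  have h1 : w ⬝ᵥ (S.G x.1)⁻¹ *ᵥ x.2.1 = 0 := by
    rw [← hx', Matrix.mulVec_mulVec, ← S.P_symm, ← Matrix.mulVec_mulVec,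
      Matrix.dotProduct_mulVec, Matrix.vecMul_transpose, hw, zero_dotProduct]
  have h2 : x.2.1 ⬝ᵥ (S.G x.1)⁻¹ *ᵥ w = 0 := by
    rw [← hx', ← Matrix.vecMul_transpose, ← Matrix.dotProduct_mulVec, Matrix.mulVec_mulVec,
      S.P_symm, ← Matrix.mulVec_mulVec, hw, Matrix.mulVec_zero, dotProduct_zero]
  rw [← (S.differentiable_H x).lineDeriv_eq_fderiv]
  refine HasLineDerivAt.lineDeriv ?_
  have h : (fun t : ℝ => S.H (x + t • ((0, w, 0) : PS n)))
      = fun t => S.H x + t ^ 2 * ((1 / 2) * (w ⬝ᵥ (S.G x.1)⁻¹ *ᵥ w)) := by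
    funext t
    simp only [H_eq, Prod.fst_add, Prod.snd_add, Prod.smul_fst, Prod.smul_snd, smul_zero, add_zero,
      Matrix.mulVec_add, Matrix.mulVec_smul, add_dotProduct, dotProduct_add, smul_dotProduct,
      dotProduct_smul, h1, h2, smul_eq_mul]
    ring_nf
  unfold HasLineDerivAt
  rw [h]
  simpa using (((hasDerivAt_id (0 : ℝ)).pow 2).mul_const
    ((1 / 2) * (w ⬝ᵥ (S.G x.1)⁻¹ *ᵥ w))).const_add (S.H x)

/-- On the constraint submanifold, the Hamiltonian and its projection have the same
differential. -/
theorem fderiv_H_comp_Gam {x : PS n} (hx : S.onM x) :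
    fderiv ℝ (S.H ∘ S.Gam) x = fderiv ℝ S.H x := by
  refine ContinuousLinearMap.ext fun v => ?_
  rw [S.fderiv_comp_Gam S.differentiable_H hx, ← sub_eq_zero, ← map_sub]
  set u := fderiv ℝ S.Gam x v - v with hu
  have hu' : u = (0, u.2.1, 0) := by
    refine Prod.ext ?_ (Prod.ext rfl ?_)
    · simp [hu, S.fderiv_Gam_fst]
    · simp [hu, S.fderiv_Gam_snd_snd]
  have hker : fderiv ℝ S.Gam x u = 0 := by
    rw [hu, map_sub, S.fderiv_Gam_fderiv_Gam hx, sub_self]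
  rw [hu', S.fderiv_Gam_momentum] at hker
  rw [hu']
  exact S.fderiv_H_momentum_eq_zero hx (congrArg (fun y : PS n => y.2.1) hker)

end MechSetting

/-- the contact Eden bracket provides the evolution of observables:
`X_{H,M}(f) = {H,f}_E − f ∂H/∂z` on `M×ℝ`, where `X_{H,M} = TΓ(X_H)`. -/
theorem statement_13 {n : ℕ} (S : MechSetting n)
    (f : PS n → ℝ) (hf : ContDiff ℝ (⊤ : ℕ∞) f) (x : PS n) (hx : S.onM x) :
    fderiv ℝ f x (fderiv ℝ S.Gam x (XH S.H x))
      = jacB (S.H ∘ S.Gam) (f ∘ S.Gam) x - f x * pdz S.H x := by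
  rw [← S.fderiv_comp_Gam (hf.differentiable (by simp)) hx, fderiv_XH,
    jacB_congr (F := S.H ∘ S.Gam) (f ∘ S.Gam) (congrArg S.H (S.Gam_eq_self hx))
      (S.fderiv_H_comp_Gam hx),
    Function.comp_apply, S.Gam_eq_self hx]
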